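/- arXiv:2207.14586 — 2 statements merged into one kernel-verified Lean document; each statement's English description precedes it below -/
import Mathlib

section
/- Let t and r be positive integers and let k, N, n be nonnegative integers. The number of partitions λ with λ_1 = k, |λ| = N, and λ_r + λ_{t+r} + λ_{2t+r} + ⋯ = n equals the number of pairs (f, g), where f : {1, …, r−1} → ℕ and g : ℕ × {1, …, t} → ℕ is finitely supported, such that ∑_{j=1}^{r−1} f(j) + ∑_{m≥0} ∑_{i=1}^{t} g(m,i) = k, ∑_{j=1}^{r−1} j·f(j) + ∑_{m≥0} ∑_{i=1}^{t} (mt + r + i − 1)·g(m,i) = N, and ∑_{m≥0} ∑_{i=1}^{t} (m+1)·g(m,i) = n. (This is the coefficient-wise form of the main identity ∑_{λ∈𝒫} z^{λ_1} s^{|λ|} q^{λ_r+λ_{t+r}+λ_{2t+r}+⋯} = (1/(sz;s)_{r−1}) ∏_{m≥0} 1/(s^{mt+r} q^{m+1} z; s)_t.) -/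
/-- A partition: a weakly decreasing sequence of naturals with finite support.
`p.parts i` is the `(i+1)`-st part, i.e. parts are 0-indexed (`λ_1 = p.parts 0`). -/
structure Ptn where
  parts : ℕ → ℕ
  antitone' : ∀ ⦃i j : ℕ⦄, i ≤ j → parts j ≤ parts i
  finite_support' : (Function.support parts).Finite

namespace Ptn

/-- The size `|λ|` of a partition: the sum of all its parts. -/
noncomputable def size (p : Ptn) : ℕ := ∑ᶠ i, p.parts i

/-- The number of (nonzero) parts `ℓ(λ)`. -/
noncomputable def length (p : Ptn) : ℕ := (Function.support p.parts).ncard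

/-- A partition has distinct parts if no nonzero value is repeated. -/
def Distinct (p : Ptn) : Prop := ∀ i : ℕ, p.parts (i + 1) ≠ 0 → p.parts (i + 1) < p.parts i

/-- A partition has odd parts if every part is odd. -/
def OddParts (p : Ptn) : Prop := ∀ i : ℕ, p.parts i ≠ 0 → Odd (p.parts i)

end Ptn

open Function in
/-- A finitely supported sum over a sum type splits into the sums over its two summands. -/
theorem finsum_sumType {α β M : Type*} [AddCommMonoid M] (h : α ⊕ β → M)
    (hf : (support h).Finite) :
    ∑ᶠ x, h x = ∑ᶠ a, h (Sum.inl a) + ∑ᶠ b, h (Sum.inr b) := by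
  classical
  have hl : (support fun a => h (Sum.inl a)).Finite :=
    hf.preimage Sum.inl_injective.injOn
  have hr : (support fun b => h (Sum.inr b)).Finite :=
    hf.preimage Sum.inr_injective.injOn
  rw [finsum_eq_sum_of_support_subset (s := hl.toFinset.disjSum hr.toFinset),
    Finset.sum_disjSum, finsum_eq_sum _ hl, finsum_eq_sum _ hr]
  rintro (a | b) hx <;> simpa using hx

namespace Ptn

theorem ext_parts {p p' : Ptn} (h : ∀ i, p.parts i = p'.parts i) : p = p' := by
  cases p; cases p'
  simpa [funext_iff] using h

/-- The partition whose consecutive differences `λ_{i+1} - λ_{i+2}` are the values `d i`. -/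
def ofDiff (d : ℕ →₀ ℕ) : Ptn where
  parts i := ∑ j ∈ d.support, if i ≤ j then d j else 0
  antitone' i i' h := by
    refine Finset.sum_le_sum fun j _ => ?_
    split_ifs <;> omega
  finite_support' := by
    refine (Set.finite_Iic (d.support.sup id)).subset fun i hi => ?_
    obtain ⟨j, hj, hne⟩ := Finset.exists_ne_zero_of_sum_ne_zero hi
    have hij : i ≤ j := by
      by_contra h
      simp [h] at hne
    exact hij.trans (Finset.le_sup (f := id) hj)

theorem ofDiff_parts (d : ℕ →₀ ℕ) (i : ℕ) :
    (ofDiff d).parts i = ∑ j ∈ d.support, if i ≤ j then d j else 0 := rfl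

theorem ofDiff_parts_eq_add (d : ℕ →₀ ℕ) (i : ℕ) :
    (ofDiff d).parts i = d i + (ofDiff d).parts (i + 1) := by
  have hd : d i = ∑ j ∈ d.support, if j = i then d j else 0 := by
    simp +contextual [eq_comm]
  rw [hd, ofDiff_parts, ofDiff_parts, ← Finset.sum_add_distrib]
  refine Finset.sum_congr rfl fun j _ => ?_
  split_ifs <;> omega

theorem exists_parts_eq_zero (p : Ptn) : ∃ M, ∀ i, M ≤ i → p.parts i = 0 := by
  obtain ⟨M, hM⟩ := p.finite_support'.bddAbove
  refine ⟨M + 1, fun i hi => ?_⟩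
  by_contra h
  have := hM h
  omega

theorem ofDiff_bijective : Function.Bijective ofDiff := by
  constructor
  · intro d d' h
    ext i
    have h1 := ofDiff_parts_eq_add d i
    have h2 := ofDiff_parts_eq_add d' i
    rw [h] at h1
    omega
  · intro p
    let d : ℕ →₀ ℕ := Finsupp.ofSupportFinite (fun i => p.parts i - p.parts (i + 1))
      (p.finite_support'.subset fun i hi h => hi (by simp [h]))
    have hd : ∀ i, p.parts i = d i + p.parts (i + 1) := fun i =>
      (Nat.sub_add_cancel (p.antitone' (Nat.le_succ i))).symm
    obtain ⟨M, hM⟩ := p.exists_parts_eq_zero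
    obtain ⟨M', hM'⟩ := (ofDiff d).exists_parts_eq_zero
    have key : ∀ n i, max M M' ≤ n + i → (ofDiff d).parts i = p.parts i := by
      intro n
      induction n with
      | zero => intro i hi; rw [hM i (by omega), hM' i (by omega)]
      | succ n ih =>
        intro i hi
        rw [hd, ofDiff_parts_eq_add, ih (i + 1) (by omega)]
    exact ⟨d, ext_parts fun i => key _ i (Nat.le_add_right _ i)⟩

/-- A sum of parts, in terms of the number of summation indices lying below each `j`. -/
theorem finsum_ofDiff_parts (d : ℕ →₀ ℕ) (φ : ℕ → ℕ) (c : ℕ → ℕ)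
    (hc : ∀ j m, φ m ≤ j ↔ m < c j) :
    ∑ᶠ m, (ofDiff d).parts (φ m) = ∑ᶠ j, c j * d j := by
  have hsupp : ∀ j, (Function.support fun m => if φ m ≤ j then d j else 0) ⊆
      Finset.range (c j) := by
    intro j m hm
    by_contra h
    simp_all
  simp only [ofDiff_parts]
  rw [finsum_sum_comm _ _ fun j _ => (Finset.finite_toSet _).subset (hsupp j),
    finsum_eq_sum_of_support_subset (s := d.support)]
  · refine Finset.sum_congr rfl fun j _ => ?_
    rw [finsum_eq_sum_of_support_subset _ (hsupp j),
      Finset.sum_congr rfl fun m hm => if_pos ((hc j m).2 (Finset.mem_range.1 hm))]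
    simp
  · intro j hj
    simp_all

theorem ofDiff_parts_zero (d : ℕ →₀ ℕ) : (ofDiff d).parts 0 = ∑ᶠ j, d j := by
  rw [finsum_eq_sum_of_support_subset (s := d.support) _ (by simp)]
  simp [ofDiff_parts]

theorem size_ofDiff (d : ℕ →₀ ℕ) : (ofDiff d).size = ∑ᶠ j, (j + 1) * d j :=
  finsum_ofDiff_parts d id (· + 1) fun _ _ => Nat.lt_succ_iff.symm

theorem finsum_ofDiff_parts_progression (d : ℕ →₀ ℕ) {t r : ℕ} (ht : 1 ≤ t) (hr : 1 ≤ r) :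
    ∑ᶠ m, (ofDiff d).parts (m * t + r - 1) = ∑ᶠ j, ((j + t - (r - 1)) / t) * d j := by
  refine finsum_ofDiff_parts d (fun m => m * t + r - 1) _ fun j m => ?_
  rw [← Nat.succ_le_iff, Nat.le_div_iff_mul_le ht, Nat.succ_mul]
  omega

end Ptn

/-- Splits the indices `j` into `j < a` and `j = a + m * t + i` with `i < t`. -/
def blockEquiv (a t : ℕ) [NeZero t] : Fin a ⊕ ℕ × Fin t ≃ ℕ :=
  ((Equiv.refl _).sumCongr (Nat.divModEquiv t).symm).trans (finSumNatEquiv a)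

theorem blockEquiv_inl (a t : ℕ) [NeZero t] (j : Fin a) :
    blockEquiv a t (Sum.inl j) = j := rfl

theorem blockEquiv_inr (a t : ℕ) [NeZero t] (x : ℕ × Fin t) :
    blockEquiv a t (Sum.inr x) = a + (x.1 * t + x.2) := by
  simp [blockEquiv, Nat.divModEquiv, Nat.add_comm]

theorem finsum_blockEquiv (a t : ℕ) [NeZero t] (d : ℕ →₀ ℕ) (w : ℕ → ℕ) :
    ∑ᶠ j, w j * d j = ∑ j : Fin a, w j * d j +
      ∑ᶠ x : ℕ × Fin t, w (a + (x.1 * t + x.2)) * d (a + (x.1 * t + x.2)) := by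
  have hfin : (Function.support fun x => w (blockEquiv a t x) * d (blockEquiv a t x)).Finite :=
    (d.hasFiniteSupport.preimage (blockEquiv a t).injective.injOn).subset fun x hx h => by
      simp_all
  rw [← finsum_comp_equiv (blockEquiv a t), finsum_sumType _ hfin, finsum_eq_sum_of_fintype]
  simp only [blockEquiv_inl, blockEquiv_inr]

/-- The multiplicities of the generators, read off from the differences of a partition. -/
def multiplicities (a t : ℕ) (d : ℕ →₀ ℕ) : (Fin a → ℕ) × (ℕ × Fin t → ℕ) :=
  (fun j => d j, fun x => d (a + (x.1 * t + x.2)))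

theorem multiplicities_injective (a t : ℕ) [NeZero t] :
    Function.Injective (multiplicities a t) := by
  intro d d' h
  ext j
  obtain ⟨x | x, rfl⟩ := (blockEquiv a t).surjective j
  · exact congrFun (congrArg Prod.fst h) x
  · rw [blockEquiv_inr]
    exact congrFun (congrArg Prod.snd h) x

theorem exists_multiplicities_eq_iff (a t : ℕ) [NeZero t]
    (fg : (Fin a → ℕ) × (ℕ × Fin t → ℕ)) :
    (∃ d, multiplicities a t d = fg) ↔ (Function.support fg.2).Finite := by
  constructor
  · rintro ⟨d, rfl⟩
    have := d.hasFiniteSupport.preimage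
      ((blockEquiv a t).injective.comp Sum.inr_injective).injOn
    exact this.subset fun x hx => by
      simpa [blockEquiv_inr, multiplicities] using hx
  · intro h
    let e : Fin a ⊕ ℕ × Fin t →₀ ℕ := Finsupp.ofSupportFinite (Sum.elim fg.1 fg.2)
      (((Set.toFinite (Set.range Sum.inl)).union (h.image Sum.inr)).subset (by
        rintro (j | x) hx
        · exact Or.inl ⟨j, rfl⟩
        · exact Or.inr ⟨x, hx, rfl⟩))
    have he : ∀ x, (e.equivMapDomain (blockEquiv a t)) (blockEquiv a t x)
        = Sum.elim fg.1 fg.2 x := fun x => by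
      rw [Finsupp.equivMapDomain_apply, Equiv.symm_apply_apply]; rfl
    refine ⟨e.equivMapDomain (blockEquiv a t), Prod.ext (funext fun j => ?_) (funext fun x => ?_)⟩
    · exact he (Sum.inl j)
    · have := he (Sum.inr x)
      rwa [blockEquiv_inr] at this

/-- Coefficient-wise form of the main identity
`∑_{λ∈𝒫} z^{λ_1} s^{|λ|} q^{λ_r+λ_{t+r}+λ_{2t+r}+⋯}
  = (1/(sz;s)_{r-1}) ∏_{m≥0} 1/(s^{mt+r} q^{m+1} z; s)_t`.
A pair `(f, g)` records the multiplicity of each generator: `f j` (with `j : Fin (r-1)`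
encoding `j + 1 ∈ {1, …, r-1}`) that of `1/(1 - s^{j+1} z)`, and `g (m, i)` (with `i : Fin t`
encoding the color `i + 1`) that of `1/(1 - s^{mt+r+i} q^{m+1} z)`. -/
theorem main_identity (t r : ℕ) (ht : 1 ≤ t) (hr : 1 ≤ r) (k N n : ℕ) :
    {p : Ptn | p.parts 0 = k ∧ p.size = N ∧
        (∑ᶠ m : ℕ, p.parts (m * t + r - 1)) = n}.ncard
      = {fg : (Fin (r - 1) → ℕ) × (ℕ × Fin t → ℕ) |
          (Function.support fg.2).Finite ∧
          ((∑ j : Fin (r - 1), fg.1 j) + ∑ᶠ x : ℕ × Fin t, fg.2 x) = k ∧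
          ((∑ j : Fin (r - 1), ((j : ℕ) + 1) * fg.1 j)
              + ∑ᶠ x : ℕ × Fin t, (x.1 * t + r + (x.2 : ℕ)) * fg.2 x) = N ∧
          (∑ᶠ x : ℕ × Fin t, (x.1 + 1) * fg.2 x) = n}.ncard := by
  have : NeZero t := ⟨by omega⟩
  set T : Set (ℕ →₀ ℕ) := {d | ∑ᶠ j, d j = k ∧ ∑ᶠ j, (j + 1) * d j = N ∧
    ∑ᶠ j, ((j + t - (r - 1)) / t) * d j = n}
  trans T.ncard
  · rw [← Set.ncard_image_of_injective T Ptn.ofDiff_bijective.injective]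
    congr 1
    ext p
    obtain ⟨d, rfl⟩ := Ptn.ofDiff_bijective.surjective p
    rw [Ptn.ofDiff_bijective.injective.mem_set_image]
    simp only [Set.mem_ofPred_eq, T, Ptn.ofDiff_parts_zero, Ptn.size_ofDiff,
      Ptn.finsum_ofDiff_parts_progression d ht hr]
  · rw [← Set.ncard_image_of_injective T (multiplicities_injective (r - 1) t)]
    congr 1
    ext fg
    by_cases hfg : (Function.support fg.2).Finite
    · obtain ⟨d, rfl⟩ := (exists_multiplicities_eq_iff _ _ _).2 hfg
      have hk := finsum_blockEquiv (r - 1) t d fun _ => 1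
      have hn := finsum_blockEquiv (r - 1) t d fun j => (j + t - (r - 1)) / t
      have hlow : ∀ j : Fin (r - 1), ((j : ℕ) + t - (r - 1)) / t = 0 := fun j =>
        Nat.div_eq_of_lt (by omega)
      have hhigh : ∀ x : ℕ × Fin t, (r - 1 + (x.1 * t + x.2) + t - (r - 1)) / t = x.1 + 1 := by
        intro x
        rw [show r - 1 + (x.1 * t + x.2) + t - (r - 1) = x.2 + t * (x.1 + 1) by
          rw [Nat.mul_add, Nat.mul_comm t]; omega, Nat.add_mul_div_left _ _ ht,
          Nat.div_eq_of_lt x.2.2, Nat.zero_add]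
      have hN : ∀ x : ℕ × Fin t, r - 1 + (x.1 * t + x.2) + 1 = x.1 * t + r + x.2 := by
        intro x
        omega
      simp only [one_mul] at hk
      simp only [hlow, hhigh, zero_mul, Finset.sum_const_zero, zero_add] at hn
      rw [(multiplicities_injective (r - 1) t).mem_set_image]
      rw [Set.mem_ofPred_eq, Set.mem_ofPred_eq, and_iff_right hfg]
      simp only [hk, hn,
        finsum_blockEquiv (r - 1) t d (· + 1), hN, multiplicities]
    · refine iff_of_false ?_ fun h => hfg h.1
      rintro ⟨d, -, hd⟩
      exact hfg ((exists_multiplicities_eq_iff _ _ _).1 ⟨d, hd⟩)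
end

section
/- Let n, k, m be nonnegative integers. The number of partitions λ with at most 2n parts, λ_1 = k, and λ_1 + λ_3 + λ_5 + ⋯ = m equals the number of ordered pairs (α, β) of partitions, each having every part of size at most n, with ℓ(α) + ℓ(β) = k and |α| + |β| = m. (This is the coefficient-wise form of the identity ∑_{λ: ℓ(λ) ≤ 2n} z^{λ_1} q^{λ_1+λ_3+λ_5+⋯} = 1/(qz;q)_n².) -/
namespace Ptn

theorem parts_injective : Function.Injective parts := by
  rintro ⟨f, _, _⟩ ⟨g, _, _⟩ h
  cases h
  rfl

theorem exists_forall_ge_parts_eq_zero (p : Ptn) : ∃ N, ∀ i, N ≤ i → p.parts i = 0 := by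
  obtain ⟨N, hN⟩ := p.finite_support'.bddAbove
  refine ⟨N + 1, fun i hi => ?_⟩
  by_contra h
  have := hN (Function.mem_support.2 h)
  omega

/-- A weakly decreasing sequence vanishing from some index on is a partition. -/
def ofAntitone (f : ℕ → ℕ) (hf : Antitone f) (h : ∃ N, ∀ i, N ≤ i → f i = 0) : Ptn where
  parts := f
  antitone' := hf
  finite_support' := by
    obtain ⟨N, hN⟩ := h
    refine (Set.finite_Iio N).subset fun i hi => ?_
    by_contra hlt
    exact hi (hN i (not_lt.1 hlt))

theorem finite_setOf_lt_parts (p : Ptn) (j : ℕ) : {i | j < p.parts i}.Finite :=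
  p.finite_support'.subset fun i (hi : j < p.parts i) =>
    Function.mem_support.2 (by omega)

theorem lt_ncard_iff (p : Ptn) (i j : ℕ) : i < {i | j < p.parts i}.ncard ↔ j < p.parts i := by
  constructor
  · intro h
    by_contra hj
    have hsub : {i | j < p.parts i} ⊆ Set.Iio i := by
      intro x (hx : j < p.parts x)
      by_contra hxi
      have := p.antitone' (not_lt.1 hxi)
      omega
    have := Set.ncard_le_ncard hsub (Set.finite_Iio i)
    simp at this
    omega
  · intro h
    have hsub : Set.Iic i ⊆ {i | j < p.parts i} := fun x hx => h.trans_le (p.antitone' hx)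
    have := Set.ncard_le_ncard hsub (p.finite_setOf_lt_parts j)
    simp at this
    omega

/-- The conjugate partition. -/
noncomputable def conj (p : Ptn) : Ptn :=
  ofAntitone (fun j => {i | j < p.parts i}.ncard)
    (fun _ _ hab => Set.ncard_le_ncard (fun _ hi => lt_of_le_of_lt hab hi)
      (p.finite_setOf_lt_parts _))
    ⟨p.parts 0, fun j hj => by
      have := p.lt_ncard_iff 0 j
      omega⟩

theorem lt_conj_parts_iff (p : Ptn) (i j : ℕ) : i < p.conj.parts j ↔ j < p.parts i :=
  p.lt_ncard_iff i j

theorem conj_conj (p : Ptn) : p.conj.conj = p :=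
  parts_injective <| funext fun j => eq_of_forall_lt_iff fun i => by
    rw [lt_conj_parts_iff, lt_conj_parts_iff]

theorem conj_bijective : Function.Bijective conj :=
  Function.Involutive.bijective conj_conj

theorem conj_parts_zero (p : Ptn) : p.conj.parts 0 = p.length := by
  simp [conj, ofAntitone, length, Function.support, Nat.pos_iff_ne_zero]

theorem length_le_iff (p : Ptn) (n : ℕ) : p.length ≤ n ↔ p.parts n = 0 := by
  have := p.lt_conj_parts_iff n 0
  rw [conj_parts_zero] at this
  omega

theorem forall_conj_parts_le_iff (p : Ptn) (n : ℕ) :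
    (∀ i, p.conj.parts i ≤ n) ↔ p.parts n = 0 := by
  rw [← length_le_iff, ← conj_parts_zero]
  exact ⟨fun h => h 0, fun h i => (p.conj.antitone' (Nat.zero_le i)).trans h⟩

theorem length_conj (p : Ptn) : p.conj.length = p.parts 0 := by
  rw [← conj_parts_zero, conj_conj]

theorem size_eq_sum_range (p : Ptn) {N : ℕ} (h : p.parts N = 0) :
    p.size = ∑ i ∈ Finset.range N, p.parts i := by
  refine finsum_eq_sum_of_support_subset _ fun i hi => ?_
  have := @p.antitone' N i
  simp at hi ⊢
  omega

theorem size_conj (p : Ptn) : p.conj.size = p.size := by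
  obtain ⟨M, hM⟩ := p.exists_forall_ge_parts_eq_zero
  obtain ⟨M', hM'⟩ := p.conj.exists_forall_ge_parts_eq_zero
  set N := max M M'
  have card_eq (q : Ptn) (hq : q.conj.parts N = 0) (i : ℕ) :
      q.parts i = ∑ j ∈ Finset.range N, if j < q.parts i then 1 else 0 := by
    rw [← Finset.card_filter]
    have hle : q.parts i ≤ N := by
      have := q.lt_conj_parts_iff i N
      omega
    rw [show {j ∈ Finset.range N | j < q.parts i} = Finset.range (q.parts i) by
      ext j; simp; omega, Finset.card_range]
  have hp : p.parts N = 0 := hM N (le_max_left _ _)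
  have hc : p.conj.parts N = 0 := hM' N (le_max_right _ _)
  rw [size_eq_sum_range _ hp, size_eq_sum_range _ hc,
    Finset.sum_congr rfl fun i _ => card_eq p hc i,
    Finset.sum_congr rfl fun i _ => card_eq p.conj (by rwa [conj_conj]) i, Finset.sum_comm]
  simp only [lt_conj_parts_iff]

/-- The partition with parts `a₀ + b₀ ≥ a₁ + b₀ ≥ a₁ + b₁ ≥ a₂ + b₁ ≥ ⋯`. -/
def interleave (q : Ptn × Ptn) : Ptn :=
  ofAntitone (fun i => q.1.parts ((i + 1) / 2) + q.2.parts (i / 2))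
    (fun _ _ hij => add_le_add (q.1.antitone' (by omega)) (q.2.antitone' (by omega)))
    (by
      obtain ⟨M, hM⟩ := q.1.exists_forall_ge_parts_eq_zero
      obtain ⟨M', hM'⟩ := q.2.exists_forall_ge_parts_eq_zero
      exact ⟨2 * M + 2 * M', fun i hi => by
        rw [hM _ (by omega), hM' _ (by omega)]⟩)

theorem interleave_parts_even (q : Ptn × Ptn) (i : ℕ) :
    (interleave q).parts (2 * i) = q.1.parts i + q.2.parts i := by
  simp only [interleave, ofAntitone]
  congr 2 <;> omega

theorem interleave_parts_odd (q : Ptn × Ptn) (i : ℕ) :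
    (interleave q).parts (2 * i + 1) = q.1.parts (i + 1) + q.2.parts i := by
  simp only [interleave, ofAntitone]
  congr 2 <;> omega

theorem interleave_injective : Function.Injective interleave := by
  rintro ⟨a, b⟩ ⟨c, d⟩ h
  have heven i := congrArg (fun p => p.parts (2 * i)) h
  have hodd i := congrArg (fun p => p.parts (2 * i + 1)) h
  simp only [interleave_parts_even, interleave_parts_odd] at heven hodd
  obtain ⟨N, hN⟩ := a.exists_forall_ge_parts_eq_zero
  obtain ⟨N', hN'⟩ := c.exists_forall_ge_parts_eq_zero
  have hac : ∀ e i, N + N' ≤ i + e → a.parts i = c.parts i := by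
    intro e
    induction e with
    | zero => intro i hi; rw [hN i (by omega), hN' i (by omega)]
    | succ e ih =>
      intro i hi
      have := ih (i + 1) (by omega)
      have := heven i
      have := hodd i
      omega
  have hac' i := hac (N + N') i (by omega)
  refine Prod.ext (parts_injective (funext hac')) (parts_injective (funext fun i => ?_))
  have := heven i
  have := hac' i
  simp only at *
  omega

theorem interleave_surjective : Function.Surjective interleave := by
  intro p
  obtain ⟨N, hN⟩ := p.exists_forall_ge_parts_eq_zero
  let tail (f : ℕ → ℕ) : Ptn := ofAntitone (fun i => ∑ j ∈ Finset.Ico i N, f j)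
    (fun i j hij => Finset.sum_le_sum_of_subset (Finset.Ico_subset_Ico_left hij))
    ⟨N, fun i hi => by simp [hi]⟩
  let a := tail fun j => p.parts (2 * j) - p.parts (2 * j + 1)
  let b := tail fun j => p.parts (2 * j + 1) - p.parts (2 * j + 2)
  have tail_step (f : ℕ → ℕ) (i : ℕ) (hi : i < N) :
      (tail f).parts i = f i + (tail f).parts (i + 1) :=
    Finset.sum_eq_sum_Ico_succ_bot hi f
  have tail_zero (f : ℕ → ℕ) (i : ℕ) (hi : N ≤ i) : (tail f).parts i = 0 := by
    simp [tail, ofAntitone, hi]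
  have heven : ∀ e i, N ≤ i + e → a.parts i + b.parts i = p.parts (2 * i) := by
    intro e
    induction e with
    | zero =>
      intro i hi
      rw [tail_zero _ i hi, tail_zero _ i hi, hN _ (by omega)]
    | succ e ih =>
      intro i hi
      by_cases h : i < N
      · have h1 := ih (i + 1) (by omega)
        have h2 : a.parts i = _ := tail_step _ i h
        have h3 : b.parts i = _ := tail_step _ i h
        have h4 := @p.antitone' (2 * i) (2 * i + 1) (by omega)
        have h5 := @p.antitone' (2 * i + 1) (2 * i + 2) (by omega)
        rw [show 2 * (i + 1) = 2 * i + 2 by ring] at h1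
        change a.parts i = _ + a.parts (i + 1) at h2
        change b.parts i = _ + b.parts (i + 1) at h3
        omega
      · exact ih i (by omega)
  have hodd i : a.parts (i + 1) + b.parts i = p.parts (2 * i + 1) := by
    by_cases h : i < N
    · have h1 := heven N i (by omega)
      have h2 : a.parts i = _ := tail_step _ i h
      have h4 := @p.antitone' (2 * i) (2 * i + 1) (by omega)
      change a.parts i = _ + a.parts (i + 1) at h2
      omega
    · rw [tail_zero _ i (by omega), tail_zero _ (i + 1) (by omega), hN _ (by omega)]
  refine ⟨(a, b), parts_injective (funext fun i => ?_)⟩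
  obtain ⟨j, rfl | rfl⟩ := Nat.even_or_odd' i
  · rw [interleave_parts_even]; exact heven N j (by omega)
  · rw [interleave_parts_odd]; exact hodd j

theorem finsum_interleave_parts_even (q : Ptn × Ptn) :
    ∑ᶠ i, (interleave q).parts (2 * i) = q.1.size + q.2.size := by
  simp only [interleave_parts_even]
  exact finsum_add_distrib q.1.finite_support' q.2.finite_support'

theorem length_interleave_le_iff (q : Ptn × Ptn) (n : ℕ) :
    (interleave q).length ≤ 2 * n ↔ q.1.parts n = 0 ∧ q.2.parts n = 0 := by
  rw [length_le_iff, interleave_parts_even, Nat.add_eq_zero_iff]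

end Ptn

/-- Coefficient-wise form of
`∑_{λ : ℓ(λ) ≤ 2n} z^{λ_1} q^{λ_1+λ_3+λ_5+⋯} = 1/(qz;q)_n²`. -/
theorem bounded_schmidt (n k m : ℕ) :
    {p : Ptn | p.length ≤ 2 * n ∧ p.parts 0 = k ∧ (∑ᶠ i : ℕ, p.parts (2 * i)) = m}.ncard
      = {q : Ptn × Ptn | (∀ i, q.1.parts i ≤ n) ∧ (∀ i, q.2.parts i ≤ n) ∧
          q.1.length + q.2.length = k ∧ q.1.size + q.2.size = m}.ncard := by
  let e := Equiv.ofBijective Ptn.interleave ⟨Ptn.interleave_injective, Ptn.interleave_surjective⟩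
  let c := Equiv.ofBijective Ptn.conj Ptn.conj_bijective
  refine Set.ncard_congr' ((e.symm.trans (c.prodCongr c)).subtypeEquiv fun p => ?_)
  obtain ⟨q, rfl⟩ := e.surjective p
  have hzero : (Ptn.interleave q).parts 0 = q.1.parts 0 + q.2.parts 0 :=
    Ptn.interleave_parts_even q 0
  have he : e q = Ptn.interleave q := rfl
  have hc (p : Ptn) : c p = p.conj := rfl
  have hs : e.symm (Ptn.interleave q) = q := e.symm_apply_apply q
  simp [he, hc, hs, Ptn.length_interleave_le_iff,
    Ptn.finsum_interleave_parts_even, hzero, Ptn.forall_conj_parts_le_iff, Ptn.length_conj,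
    Ptn.size_conj, and_assoc]
end
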